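/- Let N ≥ 1 and let H be the N×N real symmetric tridiagonal matrix with zero diagonal and off-diagonal entries κ_n = √(n(N−n))/2 for 1 ≤ n ≤ N−1 (the J_x lattice Hamiltonian). Then the spectrum of H is exactly the set {n − (N−1)/2 : n = 0, 1, …, N−1}; in particular, when N = 2j+1 is odd, the eigenvalues of H are the integers −j, −j+1, …, j−1, j. -/

import Mathlib

open Matrix

namespace JxLattice

open Polynomial

/-- The generating polynomial whose coefficients, suitably weighted, form the `k`-th eigenvector. -/
noncomputable def genPoly (M k : ℕ) : ℝ[X] := (1 + X) ^ k * (1 - X) ^ (M - k)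

/-- The normalisation turning the Kac matrix into the symmetric `J_x` matrix. -/
noncomputable def weight (M p : ℕ) : ℝ := (√(M.choose p : ℝ))⁻¹

theorem coeff_zero_genPoly (M k : ℕ) : (genPoly M k).coeff 0 = 1 := by
  simp [genPoly, coeff_zero_eq_eval_zero]

theorem natDegree_genPoly_le {M k : ℕ} (hk : k ≤ M) : (genPoly M k).natDegree ≤ M := by
  have h1 : (1 + X : ℝ[X]).natDegree ≤ 1 := by compute_degree
  have h2 : (1 - X : ℝ[X]).natDegree ≤ 1 := by compute_degree
  have h3 := natDegree_mul_le (p := (1 + X : ℝ[X]) ^ k) (q := (1 - X) ^ (M - k))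
  have h4 := natDegree_pow_le_of_le k h1
  have h5 := natDegree_pow_le_of_le (M - k) h2
  unfold genPoly
  omega

theorem derivative_genPoly {M k : ℕ} (hk : k ≤ M) :
    (1 - X ^ 2) * derivative (genPoly M k) =
      (C (2 * k - M : ℝ) - C (M : ℝ) * X) * genPoly M k := by
  obtain ⟨l, rfl⟩ := Nat.exists_eq_add_of_le hk
  have hpow (P : ℝ[X]) (n : ℕ) : P * derivative (P ^ n) = C (n : ℝ) * P ^ n * derivative P := by
    cases n with
    | zero => simp
    | succ n => rw [derivative_pow_succ]; push_cast; simp only [map_add, map_one]; ring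
  have h1 := hpow (1 + X) k
  have h2 := hpow (1 - X) l
  simp only [derivative_add, derivative_sub, derivative_one, derivative_X] at h1 h2
  simp only [genPoly, Nat.add_sub_cancel_left, derivative_mul]
  push_cast
  simp only [map_add, map_sub, map_mul, C_ofNat]
  linear_combination (1 - X) * (1 - X) ^ l * h1 + (1 + X) * (1 + X) ^ k * h2

/-- The eigenvector recurrence at the left end of the lattice. -/
theorem coeff_one_genPoly {M k : ℕ} (hk : k ≤ M) :
    (genPoly M k).coeff 1 = (2 * k - M) * (genPoly M k).coeff 0 := by
  have h := congrArg (fun P => coeff P 0) (derivative_genPoly hk)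
  simpa [sub_mul, mul_assoc, coeff_derivative, mul_coeff_zero] using h

/-- The eigenvector recurrence away from the left end of the lattice. -/
theorem coeff_genPoly_recurrence {M k : ℕ} (hk : k ≤ M) (p : ℕ) :
    (p + 2) * (genPoly M k).coeff (p + 2) + (M - p) * (genPoly M k).coeff p =
      (2 * k - M) * (genPoly M k).coeff (p + 1) := by
  have h := congrArg (fun P => coeff P (p + 1)) (derivative_genPoly hk)
  simp only [sub_mul, one_mul, mul_assoc, coeff_sub, coeff_C_mul, coeff_X_mul,
    coeff_derivative] at h
  cases p with
  | zero =>
    rw [coeff_X_pow_mul'] at h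
    norm_num at h ⊢
    linarith
  | succ p =>
    rw [coeff_X_pow_mul', if_pos (by omega), show p + 1 + 1 - 2 = p by omega,
      coeff_derivative] at h
    push_cast at h ⊢
    linarith

theorem sqrt_mul_weight {M p : ℕ} (hp : p < M) :
    √(((p + 1) * (M - p) : ℕ) : ℝ) * weight M (p + 1) = (p + 1) * weight M p ∧
    √(((p + 1) * (M - p) : ℕ) : ℝ) * weight M p = (M - p) * weight M (p + 1) := by
  have hM : ((M - p : ℕ) : ℝ) = M - p := Nat.cast_sub hp.le
  have hs : √((p : ℝ) + 1) * √((p : ℝ) + 1) = p + 1 := Real.mul_self_sqrt (by positivity)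
  have ht : √((M - p : ℕ) : ℝ) * √((M - p : ℕ) : ℝ) = M - p := by
    rw [Real.mul_self_sqrt (by positivity), hM]
  have h0 : 0 < √(M.choose p : ℝ) :=
    Real.sqrt_pos.2 (mod_cast Nat.choose_pos hp.le)
  have h1 : 0 < √(M.choose (p + 1) : ℝ) :=
    Real.sqrt_pos.2 (mod_cast Nat.choose_pos hp)
  have h : √(M.choose (p + 1) : ℝ) * √((p : ℝ) + 1) =
      √(M.choose p : ℝ) * √((M - p : ℕ) : ℝ) := by
    rw [← Real.sqrt_mul (by positivity), ← Real.sqrt_mul (by positivity)]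
    congr 1
    exact_mod_cast Nat.choose_succ_right_eq M p
  rw [Nat.cast_mul, Real.sqrt_mul (by positivity), Nat.cast_succ, weight, weight]
  constructor
  · field_simp
    linear_combination √(M.choose (p + 1) : ℝ) * hs - √((p : ℝ) + 1) * h
  · field_simp
    linear_combination √(M.choose p : ℝ) * ht + √((M - p : ℕ) : ℝ) * h

/-- The `k`-th (unnormalised) eigenvector, extended to all of `ℕ`. -/
noncomputable def eigenvec (M k p : ℕ) : ℝ := (genPoly M k).coeff p * weight M p

theorem eigenvec_apply_zero (M k : ℕ) : eigenvec M k 0 = 1 := by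
  simp [eigenvec, weight, coeff_zero_genPoly]

/-- The coupling between the sites `p` and `p + 1` (indexed from `0`). -/
noncomputable def coupling (M p : ℕ) : ℝ := √(((p + 1) * (M - p) : ℕ) : ℝ) / 2

theorem coupling_mul_eigenvec_succ {M k p : ℕ} (hk : k ≤ M) (hp : p ≤ M) :
    coupling M p * eigenvec M k (p + 1) =
      (p + 1) * (genPoly M k).coeff (p + 1) * weight M p / 2 := by
  obtain rfl | hp := hp.eq_or_lt
  · rw [coeff_eq_zero_of_natDegree_lt (by have := natDegree_genPoly_le hk; omega)]
    simp [coupling]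
  · unfold coupling eigenvec
    linear_combination (genPoly M k).coeff (p + 1) / 2 * (sqrt_mul_weight hp).1

theorem coupling_mul_eigenvec {M k p : ℕ} (hp : p < M) :
    coupling M p * eigenvec M k p =
      (M - p) * (genPoly M k).coeff p * weight M (p + 1) / 2 := by
  unfold coupling eigenvec
  linear_combination (genPoly M k).coeff p / 2 * (sqrt_mul_weight hp).2

theorem eigenvec_equation_zero {M k : ℕ} (hk : k ≤ M) :
    coupling M 0 * eigenvec M k 1 = (k - M / 2) * eigenvec M k 0 := by
  rw [coupling_mul_eigenvec_succ hk (Nat.zero_le M), coeff_one_genPoly hk, eigenvec]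
  push_cast
  ring

theorem eigenvec_equation_succ {M k p : ℕ} (hk : k ≤ M) (hp : p < M) :
    coupling M (p + 1) * eigenvec M k (p + 2) + coupling M p * eigenvec M k p =
      (k - M / 2) * eigenvec M k (p + 1) := by
  rw [coupling_mul_eigenvec_succ hk hp, coupling_mul_eigenvec hp, eigenvec]
  have h := coeff_genPoly_recurrence hk p
  push_cast
  linear_combination weight M (p + 1) / 2 * h

theorem sum_tridiagonal {M k : ℕ} (hk : k ≤ M) {p : ℕ} (hp : p ≤ M) :
    ∑ q ∈ Finset.range (M + 1),
      (if p + 1 = q then coupling M p else if q + 1 = p then coupling M q else 0) *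
        eigenvec M k q = (k - M / 2) * eigenvec M k p := by
  have hlast : M + 1 ≤ p + 1 → coupling M p = 0 := by
    intro h
    simp [coupling, show M - p = 0 by omega]
  have hup : ∑ q ∈ Finset.range (M + 1), (if p + 1 = q then coupling M p * eigenvec M k q else 0) =
      coupling M p * eigenvec M k (p + 1) := by
    rw [Finset.sum_ite_eq]
    split_ifs with h
    · rfl
    · rw [hlast (by simpa using h), zero_mul]
  have hsplit : ∀ q, (if p + 1 = q then coupling M p else if q + 1 = p then coupling M q else 0) *
      eigenvec M k q = (if p + 1 = q then coupling M p * eigenvec M k q else 0) +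
        (if q + 1 = p then coupling M q * eigenvec M k q else 0) := by
    intro q
    split_ifs <;> first | omega | simp
  rw [Finset.sum_congr rfl fun q _ => hsplit q, Finset.sum_add_distrib, hup]
  cases p with
  | zero => simpa using eigenvec_equation_zero hk
  | succ p =>
    simp only [Nat.add_right_cancel_iff, Finset.sum_ite_eq', Finset.mem_range]
    rw [if_pos (by omega), eigenvec_equation_succ hk hp]

theorem mem_spectrum_of_mulVec_eq {n : Type*} [Fintype n] [DecidableEq n] {K : Type*} [Field K]
    {A : Matrix n n K} {c : K} {v : n → K} (hv : v ≠ 0) (h : A *ᵥ v = c • v) :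
    c ∈ spectrum K A := by
  rw [← Matrix.spectrum_toLin']
  refine Module.End.HasEigenvalue.mem_spectrum
    (Module.End.hasEigenvalue_of_hasEigenvector (x := v) ⟨?_, hv⟩)
  rw [Module.End.mem_eigenspace_iff, Matrix.toLin'_apply, h]

theorem spectrum_eq_of_card_le {n : Type*} [Fintype n] [DecidableEq n] {K : Type*} [Field K]
    {A : Matrix n n K} {S : Finset K} (hS : (S : Set K) ⊆ spectrum K A)
    (hcard : Fintype.card n ≤ S.card) : spectrum K A = S := by
  classical
  have hroots : spectrum K A = A.charpoly.roots.toFinset := by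
    ext c
    simp [Matrix.mem_spectrum_iff_isRoot_charpoly, A.charpoly_monic.ne_zero]
  rw [hroots] at hS ⊢
  refine congrArg _ (Finset.eq_of_subset_of_card_le (mod_cast hS) ?_).symm
  calc _ ≤ A.charpoly.roots.card := Multiset.toFinset_card_le _
    _ ≤ A.charpoly.natDegree := card_roots' _
    _ = Fintype.card n := A.charpoly_natDegree_eq_dim
    _ ≤ S.card := hcard

end JxLattice

/-- the spectrum of the `J_x` lattice Hamiltonian (zero diagonal,
off-diagonal entries `κ_n = √(n(N−n))/2`) is `{n − (N−1)/2 : n = 0,…,N−1}`;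
in particular, for odd `N = 2j+1` it is the set of integers `−j,…,j`. -/
theorem spectrum_Jx_lattice
    (N : ℕ) (hN : 0 < N)
    (H : Matrix (Fin N) (Fin N) ℂ)
    (hH : ∀ p q : Fin N,
      H p q =
        if (p : ℕ) + 1 = (q : ℕ) then
          ((Real.sqrt ((((p : ℕ) + 1) * (N - ((p : ℕ) + 1)) : ℕ)) / 2 : ℝ) : ℂ)
        else if (q : ℕ) + 1 = (p : ℕ) then
          ((Real.sqrt ((((q : ℕ) + 1) * (N - ((q : ℕ) + 1)) : ℕ)) / 2 : ℝ) : ℂ)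
        else 0) :
    spectrum ℂ H = {c : ℂ | ∃ n : ℕ, n < N ∧ c = (n : ℂ) - ((N : ℂ) - 1) / 2} ∧
    ∀ j : ℕ, N = 2 * j + 1 →
      spectrum ℂ H = {c : ℂ | ∃ z : ℤ, -(j : ℤ) ≤ z ∧ z ≤ (j : ℤ) ∧ c = (z : ℂ)} := by
  obtain ⟨M, rfl⟩ : ∃ M, N = M + 1 := ⟨N - 1, by omega⟩
  have heigen : ∀ k < M + 1, (k : ℂ) - M / 2 ∈ spectrum ℂ H := by
    intro k hk
    refine JxLattice.mem_spectrum_of_mulVec_eq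
      (v := fun p => (JxLattice.eigenvec M k p : ℂ)) (fun h0 => ?_) ?_
    · simpa [JxLattice.eigenvec_apply_zero] using congrFun h0 0
    · ext p
      have h := JxLattice.sum_tridiagonal (Nat.lt_succ_iff.1 hk) (Nat.lt_succ_iff.1 p.2)
      rw [Finset.sum_range] at h
      have hc := congrArg (fun x : ℝ => (x : ℂ)) h
      push_cast at hc
      simp only [Matrix.mulVec, dotProduct, Pi.smul_apply, smul_eq_mul]
      rw [← hc]
      refine Finset.sum_congr rfl fun q _ => ?_
      rw [hH]
      congr 1
      simp only [JxLattice.coupling, Nat.add_sub_add_right]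
      split_ifs <;> simp
  have hspec : spectrum ℂ H =
      {c : ℂ | ∃ n : ℕ, n < M + 1 ∧ c = (n : ℂ) - (((M + 1 : ℕ) : ℂ) - 1) / 2} := by
    rw [JxLattice.spectrum_eq_of_card_le
      (S := (Finset.range (M + 1)).image fun k : ℕ => (k : ℂ) - M / 2)]
    · ext c
      simp [eq_comm]
    · intro c hc
      obtain ⟨k, hk, rfl⟩ := Finset.mem_image.1 (Finset.mem_coe.1 hc)
      exact heigen k (Finset.mem_range.1 hk)
    · rw [Finset.card_image_of_injective _ fun a b hab => by simpa using hab]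
      simp
  refine ⟨hspec, fun j hj => ?_⟩
  obtain rfl : M = 2 * j := by omega
  rw [hspec]
  ext c
  constructor
  · rintro ⟨n, hn, rfl⟩
    refine ⟨(n : ℤ) - j, by omega, by omega, ?_⟩
    push_cast
    ring
  · rintro ⟨z, h1, h2, rfl⟩
    obtain ⟨n, hn⟩ := Int.eq_ofNat_of_zero_le (show 0 ≤ z + j by omega)
    obtain rfl : z = (n : ℤ) - j := by omega
    refine ⟨n, by omega, ?_⟩
    push_cast
    ring
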